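/- Let E ∈ ℝ, w > 0, α > 0 with S := w/α ≥ 1, let ψ : ℝ → [0,1] be measurable with ψ(x) = 1 for |x − E| ≤ 2w and ψ(x) = 0 for |x − E| ≥ 3w, and define g(z) = (πα²)^{−1/2} ∫_ℝ e^{−(x−z)²/α²} ψ(x) dx for z ∈ ℂ. Then: (i) g is entire; (ii) there is a universal constant C such that |g(z)| ≤ C for all z with |Im z| ≤ α; (iii) there is a universal constant c > 0 such that |g(z)| ≥ c for |Re z − E| ≤ 2w and |Im z| ≤ α, provided S is sufficiently large; and (iv) there are universal constants C, c > 0 such that |g(z)| ≤ C·e^{−cS²} for |Re z − E| ≥ 4w and |Im z| ≤ α. -/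

import Mathlib

open MeasureTheory

/-- The Gaussian mollification `g(z) = (πα²)^{-1/2} ∫ e^{-(x-z)²/α²} ψ(x) dx` of the
cutoff `ψ`, evaluated at a complex argument. -/
noncomputable def gaussCutoff (α : ℝ) (ψ : ℝ → ℝ) (z : ℂ) : ℂ :=
  (((Real.pi * α ^ 2) ^ (-(1 / 2 : ℝ)) : ℝ) : ℂ) *
    ∫ x : ℝ, Complex.exp (-((x : ℂ) - z) ^ 2 / (α : ℂ) ^ 2) * ((ψ x : ℝ) : ℂ)

/-- `ψ` is a measurable cutoff adapted to the window `[E - 2w, E + 2w]`: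
`0 ≤ ψ ≤ 1`, `ψ = 1` for `|x - E| ≤ 2w`, and `ψ = 0` for `|x - E| ≥ 3w`. -/
def IsWindowCutoff (E w : ℝ) (ψ : ℝ → ℝ) : Prop :=
  Measurable ψ ∧ (∀ x, ψ x ∈ Set.Icc (0 : ℝ) 1) ∧
    (∀ x, |x - E| ≤ 2 * w → ψ x = 1) ∧ (∀ x, 3 * w ≤ |x - E| → ψ x = 0)


lemma gc_exp_form (t y : ℝ) :
    Complex.exp (-((t : ℂ) - y * Complex.I) ^ 2)
      = Complex.exp (((y ^ 2 - t ^ 2 : ℝ) : ℂ) + ((2 * t * y : ℝ) : ℂ) * Complex.I) := by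
  congr 1
  push_cast
  ring_nf
  rw [Complex.I_sq]
  ring

lemma gc_norm (t y : ℝ) :
    ‖Complex.exp (-((t : ℂ) - y * Complex.I) ^ 2)‖ = Real.exp (y ^ 2 - t ^ 2) := by
  rw [gc_exp_form, Complex.norm_exp]
  simp [-Complex.ofReal_sub, -Complex.ofReal_mul, -Complex.ofReal_pow]

lemma gc_re (t y : ℝ) :
    (Complex.exp (-((t : ℂ) - y * Complex.I) ^ 2)).re
      = Real.exp (y ^ 2 - t ^ 2) * Real.cos (2 * t * y) := by
  rw [gc_exp_form, Complex.exp_re]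
  simp [-Complex.ofReal_sub, -Complex.ofReal_mul, -Complex.ofReal_pow]

lemma gc_gauss_integrable (y : ℝ) : Integrable (fun t : ℝ => Real.exp (y ^ 2 - t ^ 2)) := by
  have h := (integrable_exp_neg_mul_sq (b := 1) one_pos).const_mul (Real.exp (y ^ 2))
  refine h.congr (Filter.Eventually.of_forall fun t => ?_)
  simp only
  rw [← Real.exp_add]
  congr 1
  ring

lemma gc_cint (y : ℝ) (φ : ℝ → ℝ) (hm : Measurable φ) (h01 : ∀ t, φ t ∈ Set.Icc (0 : ℝ) 1) :
    Integrable (fun t : ℝ => Complex.exp (-((t : ℂ) - y * Complex.I) ^ 2) * ((φ t : ℝ) : ℂ)) := by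
  refine (gc_gauss_integrable y).mono' ?_ (Filter.Eventually.of_forall fun t => ?_)
  · have : Measurable (fun t : ℝ => Complex.exp (-((t : ℂ) - y * Complex.I) ^ 2)) :=
      Continuous.measurable (by fun_prop)
    exact (this.mul (Complex.measurable_ofReal.comp hm)).aestronglyMeasurable
  · rw [norm_mul, gc_norm, Complex.norm_real, Real.norm_eq_abs, abs_of_nonneg (h01 t).1]
    exact mul_le_of_le_one_right (Real.exp_pos _).le (h01 t).2

lemma gc_rint (y : ℝ) (φ : ℝ → ℝ) (hm : Measurable φ) (h01 : ∀ t, φ t ∈ Set.Icc (0 : ℝ) 1) :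
    Integrable (fun t : ℝ => Real.exp (y ^ 2 - t ^ 2) * Real.cos (2 * t * y) * φ t) := by
  refine (gc_cint y φ hm h01).re.congr (Filter.Eventually.of_forall fun t => ?_)
  simp only [RCLike.re_to_complex, Complex.re_mul_ofReal, gc_re]

lemma gc_re_integral (y : ℝ) (φ : ℝ → ℝ) (hm : Measurable φ)
    (h01 : ∀ t, φ t ∈ Set.Icc (0 : ℝ) 1) :
    (∫ t : ℝ, Complex.exp (-((t : ℂ) - y * Complex.I) ^ 2) * ((φ t : ℝ) : ℂ)).re
      = ∫ t : ℝ, Real.exp (y ^ 2 - t ^ 2) * Real.cos (2 * t * y) * φ t := by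
  have h := integral_re (gc_cint y φ hm h01)
  simp only [RCLike.re_to_complex] at h
  rw [← h]
  simp only [Complex.re_mul_ofReal, gc_re]

lemma gc_full (y : ℝ) :
    ∫ t : ℝ, Real.exp (y ^ 2 - t ^ 2) * Real.cos (2 * t * y) = √Real.pi := by
  have h := gc_re_integral y (fun _ => 1) measurable_const (fun _ => by simp)
  simp only [mul_one, Complex.ofReal_one] at h
  rw [← h]
  have h2 := GaussianFourier.integral_cexp_neg_mul_sq_add_real_mul_I (b := 1) (by simp) (-y)
  have h3 : (∫ t : ℝ, Complex.exp (-((t : ℂ) - y * Complex.I) ^ 2))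
      = (Real.pi : ℂ) ^ (1 / 2 : ℂ) := by
    rw [← div_one (Real.pi : ℂ), ← h2]
    congr 1
    ext t
    congr 1
    push_cast
    ring
  rw [h3, Real.sqrt_eq_rpow, show (1 / 2 : ℂ) = ((1 / 2 : ℝ) : ℂ) by push_cast; rfl,
    ← Complex.ofReal_cpow Real.pi_pos.le, Complex.ofReal_re]

lemma gc_half (y : ℝ) :
    ∫ t in Set.Iic (0 : ℝ), Real.exp (y ^ 2 - t ^ 2) * Real.cos (2 * t * y) = √Real.pi / 2 := by
  have hi : Integrable (fun t : ℝ => Real.exp (y ^ 2 - t ^ 2) * Real.cos (2 * t * y)) := by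
    simpa using gc_rint y (fun _ => 1) measurable_const (fun _ => by simp)
  have h1 := integral_add_compl (measurableSet_Iic (a := (0 : ℝ))) hi
  have h2 := integral_comp_neg_Iic (0 : ℝ)
    (fun t : ℝ => Real.exp (y ^ 2 - t ^ 2) * Real.cos (2 * t * y))
  simp only [even_two.neg_pow, mul_neg, neg_mul, Real.cos_neg, neg_zero] at h2
  rw [Set.compl_Iic, ← h2, gc_full] at h1
  linarith

lemma gc_num {y : ℝ} (hy : |y| ≤ 1) :
    (1 : ℝ) / 10 ≤ √Real.pi / 2
      - Real.exp (y ^ 2 + 36 / 25) * (-Real.exp ((-12 / 5) * (Real.pi / 4)) / (-12 / 5))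
      - 2 * Real.exp (y ^ 2 + 36 / 25) * (Real.exp ((12 / 5) * (-4)) / (12 / 5)) := by
  have hy2 : y ^ 2 ≤ 1 := (sq_le_one_iff_abs_le_one y).2 hy
  have hpi := Real.pi_gt_d2
  have hs : (1.77 : ℝ) ≤ √Real.pi := by
    apply Real.le_sqrt_of_sq_le
    norm_num
    linarith
  have he := Real.exp_one_lt_d9
  have h1 : Real.exp (y ^ 2 + 36 / 25) * Real.exp ((-12 / 5) * (Real.pi / 4)) ≤ 1.83 := by
    rw [← Real.exp_add]
    have h : Real.exp (3 / 5) ≤ 1.83 := by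
      refine le_of_pow_le_pow_left₀ (n := 5) (by norm_num) (by norm_num) ?_
      rw [← Real.exp_nat_mul]
      have : ((5 : ℕ) : ℝ) * (3 / 5) = ((3 : ℕ) : ℝ) * 1 := by norm_num
      rw [this, Real.exp_nat_mul]
      calc Real.exp 1 ^ 3 ≤ 2.7182818286 ^ 3 := by gcongr
        _ ≤ _ := by norm_num
    refine le_trans (Real.exp_le_exp.2 ?_) h
    linarith
  have h2 : Real.exp (y ^ 2 + 36 / 25) * Real.exp ((12 / 5) * (-4)) ≤ 1 / 128 := by
    rw [← Real.exp_add]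
    have h : Real.exp (-7) ≤ 1 / 128 := by
      rw [Real.exp_neg, inv_eq_one_div]
      apply one_div_le_one_div_of_le (by norm_num)
      have h2 : (2 : ℝ) ≤ Real.exp 1 := by
        have := Real.add_one_le_exp (1 : ℝ)
        linarith
      have h7 : Real.exp 7 = Real.exp 1 ^ 7 := by
        rw [← Real.exp_nat_mul]
        norm_num
      rw [h7]
      calc (128 : ℝ) = 2 ^ 7 := by norm_num
        _ ≤ _ := by gcongr
    refine le_trans (Real.exp_le_exp.2 ?_) h
    linarith
  nlinarith

lemma gc_lower (y : ℝ) (hy : |y| ≤ 1) (φ : ℝ → ℝ) (hm : Measurable φ)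
    (h01 : ∀ t, φ t ∈ Set.Icc (0 : ℝ) 1) (h1 : ∀ t, -4 ≤ t → t ≤ 0 → φ t = 1) :
    (1 : ℝ) / 10 ≤ ∫ t : ℝ, Real.exp (y ^ 2 - t ^ 2) * Real.cos (2 * t * y) * φ t := by
  set A : ℝ → ℝ := (Set.Iic (0 : ℝ)).indicator
    (fun t => Real.exp (y ^ 2 - t ^ 2) * Real.cos (2 * t * y)) with hA
  set B : ℝ → ℝ := (Set.Ioi (Real.pi / 4)).indicator (fun t => Real.exp ((-12 / 5) * t)) with hB
  set D : ℝ → ℝ := (Set.Iic (-4 : ℝ)).indicator (fun t => Real.exp ((12 / 5) * t)) with hD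
  have hi : Integrable (fun t : ℝ => Real.exp (y ^ 2 - t ^ 2) * Real.cos (2 * t * y)) := by
    simpa using gc_rint y (fun _ => 1) measurable_const (fun _ => by simp)
  have iA : Integrable A := hi.indicator measurableSet_Iic
  have iB : Integrable B :=
    (integrable_indicator_iff measurableSet_Ioi).2 (integrableOn_exp_mul_Ioi (by norm_num) _)
  have iD : Integrable D :=
    (integrable_indicator_iff measurableSet_Iic).2 (integrableOn_exp_mul_Iic (by norm_num) _)
  have eA : ∫ t, A t = √Real.pi / 2 := by
    rw [hA, integral_indicator measurableSet_Iic, gc_half]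
  have eB : ∫ t, B t = -Real.exp ((-12 / 5) * (Real.pi / 4)) / (-12 / 5) := by
    rw [hB, integral_indicator measurableSet_Ioi, integral_exp_mul_Ioi (by norm_num)]
  have eD : ∫ t, D t = Real.exp ((12 / 5) * (-4)) / (12 / 5) := by
    rw [hD, integral_indicator measurableSet_Iic, integral_exp_mul_Iic (by norm_num)]
  set k := Real.exp (y ^ 2 + 36 / 25) with hk
  have key : ∫ t, (A t - k * B t - 2 * k * D t) ≤
      ∫ t : ℝ, Real.exp (y ^ 2 - t ^ 2) * Real.cos (2 * t * y) * φ t := by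
    refine integral_mono ((iA.sub (iB.const_mul k)).sub (iD.const_mul (2 * k)))
      (gc_rint y φ hm h01) fun t => ?_
    simp only
    have hφ := h01 t
    have hG := Real.exp_pos (y ^ 2 - t ^ 2)
    have hc1 := Real.neg_one_le_cos (2 * t * y)
    have hc2 := Real.cos_le_one (2 * t * y)
    have hp := Real.pi_gt_three
    rcases le_or_gt t (-4) with h4 | h4
    · have a1 : A t = Real.exp (y ^ 2 - t ^ 2) * Real.cos (2 * t * y) :=
        Set.indicator_of_mem (by simp; linarith) _
      have b1 : B t = 0 := Set.indicator_of_notMem (by simp; linarith) _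
      have d1 : D t = Real.exp ((12 / 5) * t) := Set.indicator_of_mem (by simpa using h4) _
      have hb : Real.exp (y ^ 2 - t ^ 2) ≤ k * Real.exp ((12 / 5) * t) := by
        rw [hk, ← Real.exp_add]
        apply Real.exp_le_exp.2
        nlinarith [sq_nonneg (t + 6 / 5)]
      rw [a1, b1, d1]
      have : Real.cos (2 * t * y) * (1 - φ t) ≤ 1 := by nlinarith [hφ.1, hφ.2]
      nlinarith
    · have d1 : D t = 0 := Set.indicator_of_notMem (by simpa using h4) _
      rcases le_or_gt t 0 with h0 | h0
      · have a1 : A t = Real.exp (y ^ 2 - t ^ 2) * Real.cos (2 * t * y) :=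
          Set.indicator_of_mem (by simpa using h0) _
        have b1 : B t = 0 := Set.indicator_of_notMem (by simp; linarith) _
        rw [a1, b1, d1, h1 t h4.le h0]
        simp
      · have a1 : A t = 0 := Set.indicator_of_notMem (by simpa using h0) _
        rcases le_or_gt t (Real.pi / 4) with hq | hq
        · have b1 : B t = 0 := Set.indicator_of_notMem (by simpa using hq) _
          rw [a1, b1, d1]
          have hc : 0 ≤ Real.cos (2 * t * y) := by
            apply Real.cos_nonneg_of_mem_Icc
            have := abs_le.1 hy
            constructor <;> nlinarith
          have := mul_nonneg (mul_nonneg hG.le hc) hφ.1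
          linarith
        · have b1 : B t = Real.exp ((-12 / 5) * t) := Set.indicator_of_mem (by simpa using hq) _
          rw [a1, b1, d1]
          have hb : Real.exp (y ^ 2 - t ^ 2) ≤ k * Real.exp ((-12 / 5) * t) := by
            rw [hk, ← Real.exp_add]
            apply Real.exp_le_exp.2
            nlinarith [sq_nonneg (t - 6 / 5)]
          have : -1 ≤ Real.cos (2 * t * y) * φ t := by nlinarith [hφ.1, hφ.2]
          nlinarith
  have iAB : Integrable (fun t => A t - k * B t) := iA.sub (iB.const_mul k)
  rw [integral_sub iAB (iD.const_mul (2 * k)), integral_sub iA (iB.const_mul k), integral_const_mul, integral_const_mul, eA, eB, eD] at key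
  exact (gc_num hy).trans key

lemma gc_lower' (y : ℝ) (hy : |y| ≤ 1) (φ : ℝ → ℝ) (hm : Measurable φ)
    (h01 : ∀ t, φ t ∈ Set.Icc (0 : ℝ) 1) (h1 : ∀ t, 0 ≤ t → t ≤ 4 → φ t = 1) :
    (1 : ℝ) / 10 ≤ ∫ t : ℝ, Real.exp (y ^ 2 - t ^ 2) * Real.cos (2 * t * y) * φ t := by
  have h := gc_lower y hy (fun t => φ (-t)) (hm.comp measurable_neg) (fun t => h01 _)
    (fun t a b => h1 _ (by linarith) (by linarith))
  rw [← integral_neg_eq_self]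
  simpa only [even_two.neg_pow, mul_neg, neg_mul, Real.cos_neg] using h

lemma gc_scale {α : ℝ} (hα : 0 < α) (ψ : ℝ → ℝ) (z : ℂ) :
    gaussCutoff α ψ z = (((√Real.pi)⁻¹ : ℝ) : ℂ) *
      ∫ t : ℝ, Complex.exp (-((t : ℂ) - (z.im / α : ℝ) * Complex.I) ^ 2)
        * ((ψ (α * t + z.re) : ℝ) : ℂ) := by
  unfold gaussCutoff
  set F : ℝ → ℂ := fun x => Complex.exp (-((x : ℂ) - z) ^ 2 / (α : ℂ) ^ 2) * ((ψ x : ℝ) : ℂ)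
    with hF
  have h1 : ∫ x, F x = (α : ℂ) * ∫ t : ℝ, F (α * t + z.re) := by
    rw [Measure.integral_comp_mul_left (fun u => F (u + z.re)) α,
      integral_add_right_eq_self F, abs_of_pos (inv_pos.2 hα), Complex.real_smul, ← mul_assoc,
      ← Complex.ofReal_mul, mul_inv_cancel₀ hα.ne', Complex.ofReal_one, one_mul]
  have h2 : ∀ t : ℝ, F (α * t + z.re) =
      Complex.exp (-((t : ℂ) - (z.im / α : ℝ) * Complex.I) ^ 2)
        * ((ψ (α * t + z.re) : ℝ) : ℂ) := by
    intro t
    simp only [hF]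
    congr 2
    have hα' : (α : ℂ) ≠ 0 := by exact_mod_cast hα.ne'
    have hz : ((α * t + z.re : ℝ) : ℂ) - z = (α : ℂ) * t - z.im * Complex.I := by
      have h := Complex.re_add_im z
      push_cast
      linear_combination h
    rw [hz]
    push_cast
    field_simp
  have h3 : (Real.pi * α ^ 2) ^ (-(1 / 2 : ℝ)) = (√Real.pi)⁻¹ * α⁻¹ := by
    rw [Real.rpow_neg (by positivity), ← Real.sqrt_eq_rpow, Real.sqrt_mul Real.pi_pos.le,
      Real.sqrt_sq hα.le, mul_inv]
  rw [h1, h3]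
  simp only [h2]
  rw [← mul_assoc, ← Complex.ofReal_mul, inv_mul_cancel_right₀ hα.ne']

lemma gc_diff {E w α : ℝ} {ψ : ℝ → ℝ} (hψ : IsWindowCutoff E w ψ) :
    Differentiable ℂ (gaussCutoff α ψ) := by
  obtain ⟨hm, h01, -, h0⟩ := hψ
  unfold gaussCutoff
  refine Differentiable.const_mul ?_ _
  intro z₀
  set G : ℂ → ℝ → ℂ := fun z x => Complex.exp (-((x : ℂ) - z) ^ 2 / (α : ℂ) ^ 2) with hG
  set G' : ℂ → ℝ → ℂ := fun z x => Complex.exp (-((x : ℂ) - z) ^ 2 / (α : ℂ) ^ 2) *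
    (2 * ((x : ℂ) - z) / (α : ℂ) ^ 2) with hG'
  have hGd : ∀ z x, HasDerivAt (fun z => G z x) (G' z x) z := by
    intro z x
    have h := ((((hasDerivAt_id z).const_sub (x : ℂ)).pow 2).neg.div_const ((α : ℂ) ^ 2)).cexp
    refine h.congr_deriv ?_
    simp only [hG']
    simp
  have hmc : Measurable (fun x => ((ψ x : ℝ) : ℂ)) := Complex.measurable_ofReal.comp hm
  have hmG : ∀ z, AEStronglyMeasurable (fun x => G z x * ((ψ x : ℝ) : ℂ)) volume := fun z =>
    ((Continuous.measurable (by fun_prop : Continuous (G z))).mul hmc).aestronglyMeasurable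
  have hmG' : ∀ z, AEStronglyMeasurable (fun x => G' z x * ((ψ x : ℝ) : ℂ)) volume := fun z =>
    ((Continuous.measurable (by fun_prop : Continuous (G' z))).mul hmc).aestronglyMeasurable
  set K : Set ℝ := Set.Icc (E - 3 * w) (E + 3 * w) with hK
  have hsupp : ∀ x, x ∉ K → ψ x = 0 := by
    intro x hx
    apply h0
    by_contra hlt
    have := abs_lt.1 (not_le.1 hlt)
    exact hx ⟨by linarith, by linarith⟩
  have bnd : ∀ H : ℂ × ℝ → ℂ, Continuous H → ∃ M : ℝ, ∀ x, ∀ z ∈ Metric.closedBall z₀ 1,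
      ‖H (z, x) * ((ψ x : ℝ) : ℂ)‖ ≤ K.indicator (fun _ => M) x := by
    intro H hH
    obtain ⟨M, hM⟩ := ((isCompact_closedBall z₀ 1).prod
      (isCompact_Icc (a := E - 3 * w) (b := E + 3 * w))).exists_bound_of_continuousOn hH.continuousOn
    refine ⟨M, fun x z hz => ?_⟩
    by_cases hx : x ∈ K
    · rw [Set.indicator_of_mem hx, norm_mul, Complex.norm_real, Real.norm_eq_abs,
        abs_of_nonneg (h01 x).1]
      exact (mul_le_of_le_one_right (norm_nonneg _) (h01 x).2).trans (hM (z, x) ⟨hz, hx⟩)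
    · rw [Set.indicator_of_notMem hx, hsupp x hx]
      simp
  have hbi : ∀ M : ℝ, Integrable (K.indicator (fun _ => M)) := fun M =>
    (integrable_indicator_iff measurableSet_Icc).2 (by
      exact integrableOn_const (by simp))
  obtain ⟨M, hM⟩ := bnd (fun p => G p.1 p.2) (by fun_prop)
  obtain ⟨M', hM'⟩ := bnd (fun p => G' p.1 p.2) (by fun_prop)
  have h := hasDerivAt_integral_of_dominated_loc_of_deriv_le (μ := volume)
    (F := fun z x => G z x * ((ψ x : ℝ) : ℂ)) (F' := fun z x => G' z x * ((ψ x : ℝ) : ℂ))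
    (x₀ := z₀) (bound := K.indicator (fun _ => M'))
    (Metric.closedBall_mem_nhds z₀ one_pos)
    (Filter.Eventually.of_forall hmG)
    ((hbi M).mono' (hmG z₀) (Filter.Eventually.of_forall fun x =>
      hM x z₀ (Metric.mem_closedBall_self zero_le_one)))
    (hmG' z₀)
    (Filter.Eventually.of_forall hM') (hbi M')
    (Filter.Eventually.of_forall fun x z _ => (hGd z x).mul_const _)
  exact h.2.differentiableAt

lemma gc_y {α : ℝ} (hα : 0 < α) {b : ℝ} (hb : |b| ≤ α) : |b / α| ≤ 1 := by
  rw [abs_div, abs_of_pos hα]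
  exact (div_le_one hα).2 hb

/-- Properties of the Gaussian-mollified cutoff `g`: it is entire; it is uniformly
bounded on `|Im z| ≤ α`; it is bounded below on `|Re z - E| ≤ 2w`, `|Im z| ≤ α` once
`S = w/α` is large; and it is `O(e^{-cS²})` for `|Re z - E| ≥ 4w`, `|Im z| ≤ α`. -/
theorem gaussCutoff_properties :
    (∀ (E w α : ℝ) (ψ : ℝ → ℝ), 0 < α → 1 ≤ w / α → IsWindowCutoff E w ψ →
      Differentiable ℂ (gaussCutoff α ψ))
    ∧ (∃ C > 0, ∀ (E w α : ℝ) (ψ : ℝ → ℝ), 0 < α → 1 ≤ w / α → IsWindowCutoff E w ψ →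
        ∀ z : ℂ, |z.im| ≤ α → ‖gaussCutoff α ψ z‖ ≤ C)
    ∧ (∃ c > 0, ∃ S₀ : ℝ, ∀ (E w α : ℝ) (ψ : ℝ → ℝ), 0 < α → S₀ ≤ w / α →
        IsWindowCutoff E w ψ →
        ∀ z : ℂ, |z.re - E| ≤ 2 * w → |z.im| ≤ α → c ≤ ‖gaussCutoff α ψ z‖)
    ∧ (∃ C > 0, ∃ c > 0, ∀ (E w α : ℝ) (ψ : ℝ → ℝ), 0 < α → 1 ≤ w / α →
        IsWindowCutoff E w ψ →
        ∀ z : ℂ, 4 * w ≤ |z.re - E| → |z.im| ≤ α →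
          ‖gaussCutoff α ψ z‖ ≤ C * Real.exp (-c * (w / α) ^ 2)) := by
  refine ⟨fun E w α ψ _ _ h => gc_diff h, ⟨Real.exp 1, Real.exp_pos _, ?_⟩,
    ⟨(√Real.pi)⁻¹ * (1 / 10), by positivity, 2, ?_⟩,
    ⟨Real.exp 1 * √2, by positivity, 1 / 2, by norm_num, ?_⟩⟩
  · intro E w α ψ hα _ hψ z hz
    obtain ⟨hm, h01, -, -⟩ := hψ
    have hy := gc_y hα hz
    have hy2 : (z.im / α) ^ 2 ≤ 1 := (sq_le_one_iff_abs_le_one _).2 hy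
    rw [gc_scale hα, norm_mul, Complex.norm_real, Real.norm_eq_abs, abs_of_nonneg (by positivity)]
    have hi := (integrable_exp_neg_mul_sq (b := 1) one_pos).const_mul (Real.exp 1)
    have hb := norm_integral_le_of_norm_le hi (f := fun t : ℝ =>
      Complex.exp (-((t : ℂ) - (z.im / α : ℝ) * Complex.I) ^ 2)
        * ((ψ (α * t + z.re) : ℝ) : ℂ)) (Filter.Eventually.of_forall fun t => by
        rw [norm_mul, gc_norm, Complex.norm_real, Real.norm_eq_abs, abs_of_nonneg (h01 _).1]
        refine (mul_le_of_le_one_right (Real.exp_pos _).le (h01 _).2).trans ?_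
        rw [← Real.exp_add]
        apply Real.exp_le_exp.2
        linarith)
    rw [integral_const_mul, integral_gaussian, div_one] at hb
    refine (mul_le_mul_of_nonneg_left hb (by positivity)).trans (le_of_eq ?_)
    have : √Real.pi ≠ 0 := by positivity
    field_simp
  · intro E w α ψ hα hS hψ z hr hz
    obtain ⟨hm, h01, h1, -⟩ := hψ
    have hy := gc_y hα hz
    have hw : 2 * α ≤ w := (le_div_iff₀ hα).1 hS
    rw [gc_scale hα, norm_mul, Complex.norm_real, Real.norm_eq_abs, abs_of_nonneg (by positivity)]
    refine mul_le_mul_of_nonneg_left ?_ (by positivity)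
    refine le_trans ?_ (Complex.re_le_norm _)
    have hm' : Measurable (fun t => ψ (α * t + z.re)) := hm.comp (by fun_prop)
    rw [gc_re_integral _ (fun t => ψ (α * t + z.re)) hm' (fun t => h01 _)]
    have hr' := abs_le.1 hr
    rcases le_total E z.re with hE | hE
    · refine gc_lower _ hy _ hm' (fun t => h01 _) fun t ht1 ht2 => h1 _ ?_
      rw [abs_le]
      constructor <;> nlinarith
    · refine gc_lower' _ hy _ hm' (fun t => h01 _) fun t ht1 ht2 => h1 _ ?_
      rw [abs_le]
      constructor <;> nlinarith
  · intro E w α ψ hα hS hψ z hr hz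
    obtain ⟨hm, h01, -, h0⟩ := hψ
    have hy := gc_y hα hz
    have hy2 : (z.im / α) ^ 2 ≤ 1 := (sq_le_one_iff_abs_le_one _).2 hy
    have hw : 1 * α ≤ w := (le_div_iff₀ hα).1 hS
    rw [gc_scale hα, norm_mul, Complex.norm_real, Real.norm_eq_abs, abs_of_nonneg (by positivity)]
    have hi := (integrable_exp_neg_mul_sq (b := 1 / 2) (by norm_num)).const_mul
      (Real.exp 1 * Real.exp (-(1 / 2) * (w / α) ^ 2))
    have hb := norm_integral_le_of_norm_le hi (f := fun t : ℝ =>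
      Complex.exp (-((t : ℂ) - (z.im / α : ℝ) * Complex.I) ^ 2)
        * ((ψ (α * t + z.re) : ℝ) : ℂ)) (Filter.Eventually.of_forall fun t => by
        rw [norm_mul, gc_norm, Complex.norm_real, Real.norm_eq_abs, abs_of_nonneg (h01 _).1]
        rcases le_or_gt (3 * w) |α * t + z.re - E| with h3 | h3
        · rw [h0 _ h3, mul_zero]
          positivity
        refine (mul_le_of_le_one_right (Real.exp_pos _).le (h01 _).2).trans ?_
        rw [← Real.exp_add, ← Real.exp_add]
        apply Real.exp_le_exp.2
        have h4 : w ≤ α * |t| := by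
          have h5 := abs_sub (α * t + z.re - E) (α * t)
          rw [show α * t + z.re - E - α * t = z.re - E by ring, abs_mul, abs_of_pos hα] at h5
          linarith
        have h6 : w / α ≤ |t| := (div_le_iff₀ hα).2 (by linarith)
        have h7 : (w / α) ^ 2 ≤ t ^ 2 := by
          rw [← sq_abs t]
          exact pow_le_pow_left₀ (by linarith) h6 2
        linarith)
    rw [integral_const_mul, integral_gaussian, div_div_eq_mul_div, div_one,
      Real.sqrt_mul Real.pi_pos.le] at hb
    refine (mul_le_mul_of_nonneg_left hb (by positivity)).trans (le_of_eq ?_)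
    have : √Real.pi ≠ 0 := by positivity
    field_simp
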